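/- arXiv:2007.04665 — 4 statements merged into one kernel-verified Lean document; each statement's English description precedes it below -/
import Mathlib

section
/- Let X be a Banach space over ℝ or ℂ and let f := F + C : X → X be weakly coercive. Suppose (i) F : X → X is a proper continuous operator, and (ii) C : X → X is a compact operator. Then f is proper, i.e. the preimage under f of every compact subset of X is compact. -/
open Filter Topology

/-- `f : X → Y` is weakly coercive: for every sequence `uₙ`,
`‖f uₙ‖ → ∞` if and only if `‖uₙ‖ → ∞`. -/
def WeaklyCoercive {X Y : Type*} [NormedAddCommGroup X] [NormedAddCommGroup Y]
    (f : X → Y) : Prop :=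
  ∀ u : ℕ → X,
    Tendsto (fun n => ‖f (u n)‖) atTop atTop ↔ Tendsto (fun n => ‖u n‖) atTop atTop

/-- If `F : X → X` is a proper continuous operator, `C : X → X` is a compact
operator (continuous and mapping bounded sets to relatively compact sets), and
`f := F + C` is weakly coercive, then `f` is proper: the preimage under `f` of every
compact subset of `X` is compact. -/
theorem perturbation_of_proper_by_compact_is_proper
    {𝕜 : Type*} [RCLike 𝕜] {X : Type*} [NormedAddCommGroup X] [NormedSpace 𝕜 X]
    [CompleteSpace X] (F C : X → X)
    (hFcont : Continuous F)
    (hFproper : ∀ A : Set X, IsCompact A → IsCompact (F ⁻¹' A))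
    (hCcont : Continuous C)
    (hCcomp : ∀ B : Set X, Bornology.IsBounded B → IsCompact (closure (C '' B)))
    (hwc : WeaklyCoercive (fun x : X => F x + C x)) :
    ∀ A : Set X, IsCompact A → IsCompact ((fun x : X => F x + C x) ⁻¹' A) := by
  intro A hA
  have hclosed : IsClosed ((fun x : X => F x + C x) ⁻¹' A) :=
    hA.isClosed.preimage (hFcont.add hCcont)
  have hbdd : Bornology.IsBounded ((fun x : X => F x + C x) ⁻¹' A) := by
    by_contra hnb
    rw [isBounded_iff_forall_norm_le] at hnb
    push Not at hnb
    choose u hu hun using fun n : ℕ => hnb (n : ℝ)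
    have h1 : Tendsto (fun n => ‖u n‖) atTop atTop :=
      tendsto_atTop_mono (fun n => (hun n).le) tendsto_natCast_atTop_atTop
    have h2 := (hwc u).2 h1
    obtain ⟨M, hM⟩ := isBounded_iff_forall_norm_le.1 hA.isBounded
    obtain ⟨n, hn⟩ := (h2.eventually (eventually_gt_atTop M)).exists
    exact absurd (hM _ (hu n)) (not_le.2 hn)
  have hK := hFproper _ ((hA.prod (hCcomp _ hbdd)).image continuous_sub)
  refine hK.of_isClosed_subset hclosed ?_
  intro x hx
  exact ⟨(F x + C x, C x), ⟨hx, subset_closure ⟨x, hx, rfl⟩⟩, by simp⟩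
end

section
/- Let X be a Banach space over ℝ or ℂ and let f := F + C : X → X be weakly coercive. Suppose (i) F is a C¹ proper operator and there exists x₀ ∈ X such that F′(x₀) : X → X is a linear homeomorphism; (ii) C is a C¹ compact operator; (iii) for every x ∈ X the continuous linear operator f′(x) : X → X is weakly coercive. Then f is a global C¹-diffeomorphism of X onto X. -/
open Filter Topology

/-- A weakly coercive continuous linear operator is bounded below. -/
lemma wc_bounded_below {𝕜 : Type*} [RCLike 𝕜] {X : Type*} [NormedAddCommGroup X]
    [NormedSpace 𝕜 X] (T : X →L[𝕜] X) (hT : WeaklyCoercive (fun y : X => T y)) :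
    ∃ c : ℝ, 0 < c ∧ ∀ v, c * ‖v‖ ≤ ‖T v‖ := by
  by_contra! h
  have h1 : ∀ n : ℕ, ∃ v : X, ‖T v‖ < (1 / ((n : ℝ) + 1)) * ‖v‖ := fun n =>
    h (1 / ((n : ℝ) + 1)) (by positivity)
  choose v hv using h1
  have hpos : ∀ n, 0 < ‖v n‖ := fun n => by
    by_contra! h0
    have h2 : ‖v n‖ = 0 := le_antisymm h0 (norm_nonneg _)
    have := hv n
    rw [h2, mul_zero] at this
    exact absurd this (not_lt.mpr (norm_nonneg _))
  let u : ℕ → X := fun n => (((((n : ℝ) + 1) / ‖v n‖ : ℝ)) : 𝕜) • v n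
  have hun : ∀ n, ‖u n‖ = (n : ℝ) + 1 := fun n => by
    have := (hpos n).ne'
    simp only [u, norm_smul, RCLike.norm_ofReal]
    rw [abs_of_nonneg (by positivity)]
    field_simp
  have hTu : ∀ n, ‖T (u n)‖ ≤ 1 := fun n => by
    have h3 := hpos n
    have h4 := hv n
    simp only [u, map_smul, norm_smul, RCLike.norm_ofReal]
    rw [abs_of_nonneg (by positivity), div_mul_eq_mul_div, div_le_one h3]
    have h5 : (0 : ℝ) < (n : ℝ) + 1 := by positivity
    calc ((n : ℝ) + 1) * ‖T (v n)‖ ≤ ((n : ℝ) + 1) * ((1 / ((n : ℝ) + 1)) * ‖v n‖) := by gcongr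
      _ = ‖v n‖ := by field_simp
  have h6 : Tendsto (fun n => ‖u n‖) atTop atTop := by
    simp only [hun]
    exact tendsto_atTop_add_const_right _ _ tendsto_natCast_atTop_atTop
  have h7 := (hT u).mpr h6
  obtain ⟨n, hn⟩ := (h7.eventually_gt_atTop 1).exists
  exact absurd (hTu n) (not_le.mpr hn)

/-- The derivative of a compact map is a compact operator. -/
lemma compact_fderiv {𝕜 : Type*} [RCLike 𝕜] {X : Type*} [NormedAddCommGroup X]
    [NormedSpace 𝕜 X] [CompleteSpace X] (C : X → X) (x : X) (K : X →L[𝕜] X)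
    (hK : HasFDerivAt C K x)
    (hCcomp : ∀ B : Set X, Bornology.IsBounded B → IsCompact (closure (C '' B))) :
    IsCompactOperator K := by
  have key : IsCompactOperator (K : X →ₗ[𝕜] X) := by
    rw [isCompactOperator_iff_isCompact_closure_image_closedBall (K : X →ₗ[𝕜] X) one_pos]
    apply TotallyBounded.isCompact_of_isClosed _ isClosed_closure
    apply TotallyBounded.closure
    rw [Metric.totallyBounded_iff]
    intro ε hε
    have h1 := hK.isLittleO
    rw [Asymptotics.isLittleO_iff] at h1
    have h2 := h1 (show (0 : ℝ) < ε / 2 by positivity)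
    obtain ⟨δ, hδ, h3⟩ := Metric.eventually_nhds_iff.mp h2
    have hδ2 : 0 < δ / 2 := by positivity
    have htb : TotallyBounded (C '' Metric.closedBall x (δ / 2)) :=
      ((hCcomp _ Metric.isBounded_closedBall).totallyBounded).subset subset_closure
    obtain ⟨t, ht, hcov⟩ := Metric.totallyBounded_iff.mp htb (δ / 2 * (ε / 2)) (by positivity)
    let r : 𝕜 := ((δ / 2 : ℝ) : 𝕜)
    have hr : r ≠ 0 := by
      simp only [r]; exact_mod_cast hδ2.ne'
    have hrn : ‖r‖ = δ / 2 := by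
      simp only [r, RCLike.norm_ofReal]; exact abs_of_pos hδ2
    refine ⟨(fun y => r⁻¹ • (y - C x)) '' t, ht.image _, ?_⟩
    rintro _ ⟨v, hv, rfl⟩
    rw [mem_closedBall_zero_iff] at hv
    have hrv : ‖r • v‖ ≤ δ / 2 := by
      rw [norm_smul, hrn]
      nlinarith
    have hmem : C (x + r • v) ∈ C '' Metric.closedBall x (δ / 2) :=
      ⟨_, by simpa [Metric.mem_closedBall, dist_eq_norm] using hrv, rfl⟩
    have h4 := hcov hmem
    simp only [Set.mem_iUnion, Metric.mem_ball] at h4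
    obtain ⟨y, hy, hyd⟩ := h4
    simp only [Set.mem_iUnion, Metric.mem_ball]
    refine ⟨_, ⟨y, hy, rfl⟩, ?_⟩
    have h5 := @h3 (x + r • v) (by rw [dist_eq_norm]; simp only [add_sub_cancel_left]; linarith)
    simp only [add_sub_cancel_left] at h5
    have h6 : (K v) - r⁻¹ • (y - C x) =
        r⁻¹ • ((C (x + r • v) - y) - (C (x + r • v) - C x - K (r • v))) := by
      have : K v = r⁻¹ • K (r • v) := by
        rw [map_smul, smul_smul, inv_mul_cancel₀ hr, one_smul]
      rw [this, ← smul_sub]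
      congr 1
      abel
    change dist (K v) _ < ε
    rw [dist_eq_norm, h6, norm_smul, norm_inv, hrn, inv_mul_lt_iff₀ hδ2]
    rw [dist_eq_norm] at hyd
    have h7 := norm_sub_le (C (x + r • v) - y) (C (x + r • v) - C x - K (r • v))
    have h8 : ε / 2 * ‖r • v‖ ≤ ε / 2 * (δ / 2) := by gcongr
    nlinarith
  exact key

/-- Invertible plus compact, injective, implies invertible. -/
lemma isUnit_add_compact {𝕜 : Type*} [RCLike 𝕜] {X : Type*} [NormedAddCommGroup X]
    [NormedSpace 𝕜 X] [CompleteSpace X] (A K : X →L[𝕜] X) (hA : IsUnit A)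
    (hK : IsCompactOperator K) (hinj : ∀ v, (A + K) v = 0 → v = 0) : IsUnit (A + K) := by
  obtain ⟨a, rfl⟩ := hA
  have hT : IsCompactOperator ((↑a⁻¹ : X →L[𝕜] X) * K) := hK.clm_comp (↑a⁻¹ : X →L[𝕜] X)
  have hfac : (a : X →L[𝕜] X) + K = a * (1 + (↑a⁻¹ : X →L[𝕜] X) * K) := by
    rw [mul_add, mul_one, ← mul_assoc, Units.mul_inv, one_mul]
  rcases hT.hasEigenvalue_or_mem_resolventSet (μ := (-1 : 𝕜)) (by simp) with h | h
  · exfalso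
    obtain ⟨v, hv⟩ := h.exists_hasEigenvector
    have h1 := hv.apply_eq_smul
    refine hv.2 (hinj v ?_)
    rw [hfac]
    have h2 : ((↑a⁻¹ : X →L[𝕜] X) * K) v = (-1 : 𝕜) • v := h1
    change (a : X →L[𝕜] X) (v + ((↑a⁻¹ : X →L[𝕜] X) * K) v) = 0
    rw [h2]
    simp
  · rw [spectrum.mem_resolventSet_iff, ← IsUnit.neg_iff] at h
    rw [hfac]
    refine a.isUnit.mul ?_
    convert h using 1
    simp [add_comm]

/-- Units are closed within bounded-below operators along a continuous family. -/
lemma isUnit_all {𝕜 : Type*} [RCLike 𝕜] {X : Type*} [NormedAddCommGroup X]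
    [NormedSpace 𝕜 X] [CompleteSpace X] {Y : Type*} [TopologicalSpace Y] [PreconnectedSpace Y]
    (D : Y → X →L[𝕜] X) (hD : Continuous D)
    (hb : ∀ y, ∃ c : ℝ, 0 < c ∧ ∀ v, c * ‖v‖ ≤ ‖D y v‖) (y₀ : Y) (h₀ : IsUnit (D y₀)) (y : Y) :
    IsUnit (D y) := by
  let S : Set Y := {y | IsUnit (D y)}
  have hopen : IsOpen S := (Units.isOpen (R := X →L[𝕜] X)).preimage hD
  have hclosed : IsClosed S := by
    rw [← closure_subset_iff_isClosed]
    intro x hx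
    obtain ⟨c, hc, hcb⟩ := hb x
    have hnear : {z | ‖D z - D x‖ < c / 2} ∈ 𝓝 x := by
      have := Metric.continuousAt_iff'.mp (hD.continuousAt (x := x)) (c / 2) (by positivity)
      simp only [dist_eq_norm] at this
      exact this
    obtain ⟨z, hz, hzS⟩ := mem_closure_iff_nhds.mp hx _ hnear
    obtain ⟨a, ha⟩ := (hzS : IsUnit (D z))
    have hz' : ‖D z - D x‖ < c / 2 := hz
    have hzb : ∀ v, c / 2 * ‖v‖ ≤ ‖D z v‖ := fun v => by
      have h1 := hcb v
      have h2 := (D z - D x).le_opNorm v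
      have h3 : ‖D x v‖ ≤ ‖D z v‖ + ‖(D z - D x) v‖ := by
        have := norm_sub_le (D z v) ((D z - D x) v)
        simpa using this
      have h4 : ‖D z - D x‖ * ‖v‖ ≤ c / 2 * ‖v‖ := by gcongr
      linarith
    have hinv : ‖(↑a⁻¹ : X →L[𝕜] X)‖ ≤ 2 / c := by
      refine ContinuousLinearMap.opNorm_le_bound _ (by positivity) fun w => ?_
      have h1 := hzb ((↑a⁻¹ : X →L[𝕜] X) w)
      have h2 : D z ((↑a⁻¹ : X →L[𝕜] X) w) = w := by
        rw [← ha]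
        change ((a : X →L[𝕜] X) * (↑a⁻¹ : X →L[𝕜] X)) w = w
        rw [Units.mul_inv]; rfl
      rw [h2] at h1
      rw [div_mul_eq_mul_div, le_div_iff₀ hc]
      linarith
    have hfac : D x = a * (1 - (↑a⁻¹ : X →L[𝕜] X) * (D z - D x)) := by
      rw [mul_sub, mul_one, ← mul_assoc, Units.mul_inv, one_mul, ha]; abel
    have hlt : ‖(↑a⁻¹ : X →L[𝕜] X) * (D z - D x)‖ < 1 := by
      calc _ ≤ ‖(↑a⁻¹ : X →L[𝕜] X)‖ * ‖D z - D x‖ := norm_mul_le _ _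
        _ ≤ 2 / c * ‖D z - D x‖ := by gcongr
        _ < 2 / c * (c / 2) := by gcongr
        _ = 1 := by field_simp
    change IsUnit (D x)
    rw [hfac]
    exact a.isUnit.mul (isUnit_one_sub_of_norm_lt_one hlt)
  have huniv : S = Set.univ := IsClopen.eq_univ ⟨hclosed, hopen⟩ ⟨y₀, h₀⟩
  have hy : y ∈ S := by rw [huniv]; exact Set.mem_univ y
  exact hy

/-- A proper local homeomorphism of a real normed space is bijective. -/
lemma bijective_of_proper {X : Type*} [NormedAddCommGroup X] [NormedSpace ℝ X]
    (f : X → X) (hf : IsProperMap f) (hl : IsLocalHomeomorph f) : Function.Bijective f := by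
  have hcov : IsCoveringMap f := by
    rw [isCoveringMap_iff_isCoveringMapOn_univ]
    refine hf.isClosedMap.isCoveringMapOn_of_isLocalHomeomorphOn (fun x _ => ?_)
      (fun x _ => hl x)
    refine (hf.isCompact_preimage isCompact_singleton).finite
      (IsDiscrete.of_openPartialHomeomorph f (x := x) subset_rfl fun e _ => ?_)
    obtain ⟨φ, h1, h2⟩ := hl e
    exact ⟨φ, h1, h2.symm⟩
  have hlift : ∀ a : X, ∃ G : X → X, G (f a) = a ∧ (∀ y, f (G y) = y) ∧ ∀ x, G (f x) = x := by
    intro a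
    obtain ⟨G, ⟨h1, h2⟩, -⟩ :=
      hcov.existsUnique_continuousMap_lifts (ContinuousMap.id X) (f a) a rfl
    have h3 : ∀ y, f (G y) = y := fun y => congrFun h2 y
    refine ⟨G, h1, h3, fun x => ?_⟩
    have := hcov.eq_of_comp_eq (g₁ := G ∘ f) (g₂ := id) (G.continuous.comp hf.continuous)
      continuous_id (by ext y; simp [h3]) a h1
    exact congrFun this x
  obtain ⟨G, -, h2, h3⟩ := hlift 0
  exact ⟨Function.LeftInverse.injective h3, Function.RightInverse.surjective h2⟩

/-- Properness of the perturbed operator. -/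
lemma proper_perturbed {X : Type*} [NormedAddCommGroup X] (F C : X → X)
    (hwc : WeaklyCoercive (fun x : X => F x + C x)) (hf : Continuous fun x => F x + C x)
    (hFproper : ∀ A : Set X, IsCompact A → IsCompact (F ⁻¹' A))
    (hCcomp : ∀ B : Set X, Bornology.IsBounded B → IsCompact (closure (C '' B))) :
    IsProperMap (fun x => F x + C x) := by
  rw [isProperMap_iff_isCompact_preimage]
  refine ⟨hf, fun K hK => ?_⟩
  set B := (fun x => F x + C x) ⁻¹' K with hB
  have hbdd : Bornology.IsBounded B := by
    by_contra hnb
    have h1 : ∀ n : ℕ, ∃ x ∈ B, (n : ℝ) < ‖x‖ := by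
      intro n
      by_contra! h2
      exact hnb (isBounded_iff_forall_norm_le.mpr ⟨n, h2⟩)
    choose u hu hun using h1
    have h3 := (hwc u).mpr (tendsto_atTop_mono (fun n => (hun n).le) tendsto_natCast_atTop_atTop)
    obtain ⟨M, hM⟩ := isBounded_iff_forall_norm_le.mp hK.isBounded
    obtain ⟨n, hn⟩ := (h3.eventually_gt_atTop M).exists
    exact absurd (hM _ (hu n)) (not_le.mpr hn)
  have hc := hFproper _ ((hK.prod (hCcomp B hbdd)).image continuous_sub)
  refine hc.of_isClosed_subset (hK.isClosed.preimage hf) fun x hx => ?_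
  exact ⟨(F x + C x, C x), ⟨hx, subset_closure ⟨x, hx, rfl⟩⟩, by simp⟩

/-- Let `f := F + C : X → X` be weakly coercive, where `F` is a `C¹` proper
operator with `F′(x₀)` a linear homeomorphism for some `x₀`, `C` is a `C¹` compact
operator, and `f′(x)` is weakly coercive for every `x`. Then `f` is a global
`C¹`-diffeomorphism of `X` onto `X`. -/
theorem perturbed_operator_is_global_C1_diffeomorphism
    {𝕜 : Type*} [RCLike 𝕜] {X : Type*} [NormedAddCommGroup X] [NormedSpace 𝕜 X]
    [CompleteSpace X] (F C : X → X)
    (hwc : WeaklyCoercive (fun x : X => F x + C x))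
    (hF : ContDiff 𝕜 1 F)
    (hFproper : ∀ A : Set X, IsCompact A → IsCompact (F ⁻¹' A))
    (x₀ : X) (hx₀ : Function.Bijective (fderiv 𝕜 F x₀))
    (hx₀inv : Continuous (Function.invFun (fderiv 𝕜 F x₀)))
    (hC : ContDiff 𝕜 1 C)
    (hCcomp : ∀ B : Set X, Bornology.IsBounded B → IsCompact (closure (C '' B)))
    (hderiv : ∀ x : X, WeaklyCoercive (fun y : X => fderiv 𝕜 (fun z : X => F z + C z) x y)) :
    Function.Bijective (fun x : X => F x + C x) ∧
      ContDiff 𝕜 1 (fun x : X => F x + C x) ∧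
      ContDiff 𝕜 1 (Function.invFun (fun x : X => F x + C x)) := by
  have hf : ContDiff 𝕜 1 (fun x : X => F x + C x) := hF.add hC
  have hFd : Differentiable 𝕜 F := hF.differentiable one_ne_zero
  have hCd : Differentiable 𝕜 C := hC.differentiable one_ne_zero
  have hfd : Differentiable 𝕜 (fun x : X => F x + C x) := hf.differentiable one_ne_zero
  let _ : NormedSpace ℝ X := NormedSpace.restrictScalars ℝ 𝕜 X
  have hb := fun x => wc_bounded_below _ (hderiv x)
  have h0 : IsUnit (fderiv 𝕜 (fun z : X => F z + C z) x₀) := by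
    have hsum : fderiv 𝕜 (fun z : X => F z + C z) x₀ = fderiv 𝕜 F x₀ + fderiv 𝕜 C x₀ :=
      fderiv_fun_add (hFd x₀) (hCd x₀)
    rw [hsum]
    refine isUnit_add_compact _ _ (ContinuousLinearMap.isUnit_iff_bijective.mpr hx₀)
      (compact_fderiv C x₀ _ (hCd x₀).hasFDerivAt hCcomp) fun v hv => ?_
    obtain ⟨c, hc, hcb⟩ := hb x₀
    have h1 := hcb v
    rw [hsum, hv, norm_zero] at h1
    have h2 : ‖v‖ ≤ 0 := by
      by_contra! h3
      exact absurd h1 (not_le.mpr (mul_pos hc h3))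
    exact norm_le_zero_iff.mp h2
  have hunit := isUnit_all (fderiv 𝕜 (fun z : X => F z + C z)) (hf.continuous_fderiv one_ne_zero)
    hb x₀ h0
  let e : X → X ≃L[𝕜] X := fun x => ContinuousLinearEquiv.unitsEquiv 𝕜 X (hunit x).unit
  have he : ∀ x, HasFDerivAt (fun x : X => F x + C x) (e x : X →L[𝕜] X) x := fun x => by
    have : (e x : X →L[𝕜] X) = fderiv 𝕜 (fun z : X => F z + C z) x := by
      ext v; rfl
    rw [this]
    exact (hfd x).hasFDerivAt
  have hl : IsLocalHomeomorph (fun x : X => F x + C x) := fun x =>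
    ⟨hf.contDiffAt.toOpenPartialHomeomorph _ (he x) one_ne_zero,
      hf.contDiffAt.mem_toOpenPartialHomeomorph_source (he x) one_ne_zero, rfl⟩
  have hbij := bijective_of_proper _
    (proper_perturbed F C hwc hf.continuous hFproper hCcomp) hl
  refine ⟨hbij, hf, ?_⟩
  let h : X ≃ₜ X := (Equiv.ofBijective _ hbij).toHomeomorphOfContinuousOpen
    hf.continuous hl.isOpenMap
  have hs : ContDiff 𝕜 1 h.symm := h.contDiff_symm (f₀' := e) he hf
  have heq : Function.invFun (fun x : X => F x + C x) = h.symm := by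
    ext y
    apply hbij.1
    have h1 := Function.invFun_eq (hbij.2 y)
    have h2 : h (h.symm y) = y := h.apply_symm_apply y
    exact h1.trans h2.symm
  rw [heq]
  exact hs
end

section
/- Let X be a Banach space over ℝ or ℂ and let f := I + K + C : X → X be weakly coercive, where (i) I is the identity operator of X, (ii) K : X → X is a linear k-contractive operator with k ∈ [0,1) (i.e. a continuous linear operator with ‖K‖ ≤ k < 1), (iii) C : X → X is a C¹ compact operator, and (iv) for every x ∈ X the continuous linear operator I + K + C′(x) : X → X is weakly coercive. Then f is a global C¹-diffeomorphism of X onto X. -/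
open Filter Topology

/-- The derivative of a map sending bounded sets to relatively compact sets is compact. -/
theorem aux_fderiv_compact {𝕜 : Type*} [RCLike 𝕜] {X : Type*} [NormedAddCommGroup X]
    [NormedSpace 𝕜 X] [CompleteSpace X] {C : X → X} {T : X →L[𝕜] X} {x : X}
    (hT : HasFDerivAt C T x)
    (hCcomp : ∀ B : Set X, Bornology.IsBounded B → IsCompact (closure (C '' B))) :
    IsCompactOperator T := by
  have key : IsCompact (closure (T '' Metric.ball 0 1)) := by
    refine TotallyBounded.isCompact_of_isClosed (TotallyBounded.closure ?_) isClosed_closure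
    rw [Metric.totallyBounded_iff]
    intro ε hε
    have h1 := hT.isLittleO
    rw [hasFDerivAt_iff_isLittleO_nhds_zero] at hT
    have h2 := hT.def (c := ε / 2) (by positivity)
    rw [Metric.eventually_nhds_iff] at h2
    obtain ⟨δ', hδ', h2⟩ := h2
    obtain ⟨δ, hδ, hδδ⟩ := exists_between hδ'
    have htb : TotallyBounded (C '' Metric.ball x δ) :=
      (hCcomp _ Metric.isBounded_ball).totallyBounded.subset subset_closure
    rw [Metric.totallyBounded_iff] at htb
    obtain ⟨t, htf, ht⟩ := htb (ε / 2 * δ) (by positivity)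
    refine ⟨(fun y => ((δ⁻¹ : ℝ) : 𝕜) • (y - C x)) '' t, htf.image _, ?_⟩
    rintro _ ⟨h, hh, rfl⟩
    have hh' : ‖h‖ < 1 := by simpa using hh
    have hδ0 : ((δ : ℝ) : 𝕜) ≠ 0 := by exact_mod_cast hδ.ne'
    have hnδ : ‖((δ : ℝ) : 𝕜)‖ = δ := by simp [abs_of_pos hδ]
    have hn : ‖((δ : ℝ) : 𝕜) • h‖ < δ := by
      rw [norm_smul, hnδ]; nlinarith
    have hmem : C (x + ((δ : ℝ) : 𝕜) • h) ∈ C '' Metric.ball x δ :=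
      ⟨_, by simpa using hn, rfl⟩
    have := ht hmem
    simp only [Set.mem_iUnion, Metric.mem_ball, exists_prop] at this
    obtain ⟨y, hy, hyd⟩ := this
    simp only [Set.mem_iUnion, Metric.mem_ball, exists_prop]
    refine ⟨_, ⟨y, hy, rfl⟩, ?_⟩
    have h3 := @h2 (((δ : ℝ) : 𝕜) • h) (by simpa using hn.trans hδδ)
    rw [dist_eq_norm] at hyd ⊢
    have e : T h - ((δ⁻¹ : ℝ) : 𝕜) • (y - C x) = ((δ⁻¹ : ℝ) : 𝕜) •
        ((C (x + ((δ : ℝ) : 𝕜) • h) - y) -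
          (C (x + ((δ : ℝ) : 𝕜) • h) - C x - T (((δ : ℝ) : 𝕜) • h))) := by
      have : T h = ((δ⁻¹ : ℝ) : 𝕜) • T (((δ : ℝ) : 𝕜) • h) := by
        rw [map_smul, smul_smul]; push_cast; rw [inv_mul_cancel₀ hδ0, one_smul]
      rw [this, ← smul_sub]; congr 1; abel
    rw [e, norm_smul]
    have hnδ' : ‖((δ⁻¹ : ℝ) : 𝕜)‖ = δ⁻¹ := by simp [abs_of_pos hδ]
    rw [hnδ']
    have h4 := norm_sub_le (C (x + ((δ : ℝ) : 𝕜) • h) - y)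
          (C (x + ((δ : ℝ) : 𝕜) • h) - C x - T (((δ : ℝ) : 𝕜) • h))
    rw [inv_mul_lt_iff₀ hδ]
    nlinarith
  exact (isCompactOperator_iff_isCompact_closure_image_ball
    (T : X →ₗ[𝕜] X) (r := 1) one_pos).mpr key

/-- `A + T` with `A` invertible and `T` compact is bijective as soon as it is weakly coercive. -/
theorem aux_bijective {𝕜 : Type*} [RCLike 𝕜] {X : Type*} [NormedAddCommGroup X]
    [NormedSpace 𝕜 X] [CompleteSpace X] (A : X ≃L[𝕜] X) (T : X →L[𝕜] X)
    (hT : IsCompactOperator T) (h : WeaklyCoercive (fun y => A y + T y)) :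
    Function.Bijective (fun y => A y + T y) := by
  have hinj : ∀ y, A y + T y = 0 → y = 0 := by
    intro y hy
    by_contra hne
    have h1 := (h (fun n : ℕ => (n : 𝕜) • y)).2 (by
      simp only [norm_smul, RCLike.norm_natCast]
      exact tendsto_natCast_atTop_atTop.atTop_mul_const (norm_pos_iff.2 hne))
    have h2 : (fun n : ℕ => ‖A ((n : 𝕜) • y) + T ((n : 𝕜) • y)‖) = fun _ => 0 := by
      funext n
      rw [map_smul, map_smul, ← smul_add, hy]; simp
    simp only [h2] at h1
    exact not_tendsto_const_atTop _ _ h1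
  let S : X →L[𝕜] X := -((A.symm : X →L[𝕜] X).comp T)
  have hS : IsCompactOperator S := (hT.clm_comp (A.symm : X →L[𝕜] X)).neg
  have hAS : ∀ y, A.symm (A y + T y) = ((1 : X →L[𝕜] X) - S) y := by
    intro y; simp [S]
  rcases hS.hasEigenvalue_or_mem_resolventSet (μ := (1 : 𝕜)) one_ne_zero with he | hr
  · exfalso
    obtain ⟨v, hv⟩ := he.exists_hasEigenvector
    have h1 : S v = v := by simpa using hv.apply_eq_smul
    apply hv.2
    apply hinj
    apply A.symm.injective
    rw [hAS]; simp [h1]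
  · rw [spectrum.mem_resolventSet_iff, map_one, ContinuousLinearMap.isUnit_iff_bijective] at hr
    have : (fun y => A y + T y) = A ∘ ((1 : X →L[𝕜] X) - S : X →L[𝕜] X) := by
      funext y
      rw [Function.comp_apply, ← hAS, A.apply_symm_apply]
    rw [this]
    exact A.bijective.comp hr

/-- Compactness of preimages of convergent sequences. -/
theorem aux_subseq {𝕜 : Type*} [RCLike 𝕜] {X : Type*} [NormedAddCommGroup X]
    [NormedSpace 𝕜 X] (A : X ≃L[𝕜] X) (C : X → X)
    (hCcomp : ∀ B : Set X, Bornology.IsBounded B → IsCompact (closure (C '' B)))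
    (h : WeaklyCoercive (fun y => A y + C y)) (u : ℕ → X) (y : X)
    (hu : Tendsto (fun n => A (u n) + C (u n)) atTop (𝓝 y)) :
    ∃ x, ∃ φ : ℕ → ℕ, StrictMono φ ∧ Tendsto (u ∘ φ) atTop (𝓝 x) := by
  have hb : Bornology.IsBounded (Set.range u) := by
    by_contra hnb
    have : ∀ n : ℕ, ∃ m, (n : ℝ) ≤ ‖u m‖ := by
      by_contra! hc
      obtain ⟨n, hn⟩ := hc
      apply hnb
      rw [isBounded_iff_forall_norm_le]
      refine ⟨n, ?_⟩
      rintro _ ⟨m, rfl⟩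
      exact (hn m).le
    choose φ hφ using this
    have h1 := (h (fun n => u (φ n))).2
      (tendsto_atTop_mono hφ tendsto_natCast_atTop_atTop)
    have h2 := Metric.isBounded_range_of_tendsto _ hu
    rw [isBounded_iff_forall_norm_le] at h2
    obtain ⟨M, hM⟩ := h2
    obtain ⟨n, hn⟩ := (h1.eventually_gt_atTop M).exists
    exact absurd (hM _ ⟨φ n, rfl⟩) (not_le.2 hn)
  obtain ⟨z, -, φ, hφ, hz⟩ := (hCcomp _ hb).tendsto_subseq (x := fun n => C (u n))
    (fun n => subset_closure ⟨_, ⟨n, rfl⟩, rfl⟩)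
  refine ⟨A.symm (y - z), φ, hφ, ?_⟩
  have h1 := (A.symm.continuous.tendsto _).comp ((hu.comp hφ.tendsto_atTop).sub hz)
  convert h1 using 1
  funext n
  simp

/-- Let `f := I + K + C : X → X` be weakly coercive, where `K` is a linear
`k`-contractive operator (`‖K‖ ≤ k < 1`), `C` is a `C¹` compact operator, and
`I + K + C′(x)` is weakly coercive for every `x`. Then `f` is a global
`C¹`-diffeomorphism of `X` onto `X`. -/
theorem contractive_plus_compact_perturbation_of_identity_is_diffeomorphism
    {𝕜 : Type*} [RCLike 𝕜] {X : Type*} [NormedAddCommGroup X] [NormedSpace 𝕜 X]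
    [CompleteSpace X] (K : X →L[𝕜] X) (k : ℝ) (hk0 : 0 ≤ k) (hk1 : k < 1)
    (hK : ‖K‖ ≤ k) (C : X → X) (hC : ContDiff 𝕜 1 C)
    (hCcomp : ∀ B : Set X, Bornology.IsBounded B → IsCompact (closure (C '' B)))
    (hwc : WeaklyCoercive (fun x : X => x + K x + C x))
    (hderiv : ∀ x : X, WeaklyCoercive (fun y : X => y + K y + fderiv 𝕜 C x y)) :
    Function.Bijective (fun x : X => x + K x + C x) ∧
      ContDiff 𝕜 1 (fun x : X => x + K x + C x) ∧
      ContDiff 𝕜 1 (Function.invFun (fun x : X => x + K x + C x)) := by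
  have hKA : IsUnit ((1 : X →L[𝕜] X) + K) := by
    have := isUnit_one_sub_of_norm_lt_one (x := -K) (by rw [norm_neg]; exact hK.trans_lt hk1)
    simpa using this
  let A : X ≃L[𝕜] X := ContinuousLinearEquiv.unitsEquiv 𝕜 X hKA.unit
  have hA : ∀ x, A x = x + K x := by
    intro x
    change ((1 : X →L[𝕜] X) + K) x = _
    simp
  set f : X → X := fun x => x + K x + C x with hf
  have hfA : f = fun x => A x + C x := by funext x; simp [hf, hA]
  have hfC : ContDiff 𝕜 1 f := by
    rw [hfA]; exact A.contDiff.add hC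
  have hCd : ∀ x, HasFDerivAt C (fderiv 𝕜 C x) x := fun x =>
    ((hC.differentiable one_ne_zero) x).hasFDerivAt
  have hbij : ∀ x, Function.Bijective ((A : X →L[𝕜] X) + fderiv 𝕜 C x : X →L[𝕜] X) := by
    intro x
    have h1 := aux_bijective A (fderiv 𝕜 C x) (aux_fderiv_compact (hCd x) hCcomp)
      (by simpa only [hA] using hderiv x)
    exact h1
  let D : X → (X ≃L[𝕜] X) := fun x => ContinuousLinearEquiv.ofBijective
    ((A : X →L[𝕜] X) + fderiv 𝕜 C x) (LinearMap.ker_eq_bot.2 (hbij x).1)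
    (LinearMap.range_eq_top.2 (hbij x).2)
  have hD : ∀ x, HasFDerivAt f (D x : X →L[𝕜] X) x := by
    intro x
    have h1 : (D x : X →L[𝕜] X) = (A : X →L[𝕜] X) + fderiv 𝕜 C x := by
      ext y; simp [D]
    rw [h1, hfA]
    exact A.hasFDerivAt.add (hCd x)
  have hloc : IsLocalHomeomorph f := by
    apply IsLocalHomeomorph.mk
    intro x
    exact ⟨hfC.contDiffAt.toOpenPartialHomeomorph f (hD x) one_ne_zero,
      hfC.contDiffAt.mem_toOpenPartialHomeomorph_source (hD x) one_ne_zero, fun _ _ => rfl⟩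
  have hcont : Continuous f := hfC.continuous
  have hsub : ∀ (u : ℕ → X) (y : X), Tendsto (fun n => f (u n)) atTop (𝓝 y) →
      ∃ x, ∃ φ : ℕ → ℕ, StrictMono φ ∧ Tendsto (u ∘ φ) atTop (𝓝 x) := by
    intro u y hu
    refine aux_subseq A C hCcomp (by simpa only [hfA] using hwc) u y (by simpa only [hfA] using hu)
  have hclosed : IsClosedMap f := by
    intro s hs
    apply IsSeqClosed.isClosed
    intro v y hv hvy
    choose u hus huv using hv
    obtain ⟨x, φ, hφ, hx⟩ := hsub u y (by simpa only [huv] using hvy)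
    refine ⟨x, hs.mem_of_tendsto hx (Eventually.of_forall fun n => hus _), ?_⟩
    refine tendsto_nhds_unique ((hcont.tendsto x).comp hx) ?_
    have := hvy.comp hφ.tendsto_atTop
    refine this.congr fun n => ?_
    simp [huv]
  have hfin : ∀ y, (f ⁻¹' {y}).Finite := by
    intro y
    have hc : IsCompact (f ⁻¹' {y}) := by
      apply IsSeqCompact.isCompact
      intro u hu
      have hu' : ∀ n, f (u n) = y := hu
      obtain ⟨x, φ, hφ, hx⟩ := hsub u y (by simp only [hu']; exact tendsto_const_nhds)
      exact ⟨x, (isClosed_singleton.preimage hcont).mem_of_tendsto hx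
        (Eventually.of_forall fun n => hu _), φ, hφ, hx⟩
    refine hc.finite (IsDiscrete.of_openPartialHomeomorph f subset_rfl fun e _ => ?_)
    obtain ⟨φ, h1, h2⟩ := hloc e
    exact ⟨φ, h1, h2.symm⟩
  have hcov : IsCoveringMap f := by
    rw [isCoveringMap_iff_isCoveringMapOn_univ]
    exact hclosed.isCoveringMapOn_of_isLocalHomeomorphOn (fun x _ => hfin x)
      hloc.isLocalHomeomorphOn
  letI : NormedSpace ℝ X := NormedSpace.restrictScalars ℝ 𝕜 X
  haveI : SimplyConnectedSpace X := inferInstance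
  haveI : LocallyPathConnectedSpace X := inferInstance
  obtain ⟨F, ⟨hF0, hF⟩, -⟩ := hcov.existsUnique_continuousMap_lifts
    (ContinuousMap.id X) (f 0) 0 rfl
  have hright : ∀ y, f (F y) = y := fun y => congrFun hF y
  have hleft : F ∘ f = id := hcov.eq_of_comp_eq (F.continuous.comp hcont) continuous_id
    (by funext x; simp [hright]) 0 hF0
  have hbf : Function.Bijective f :=
    ⟨Function.LeftInverse.injective (g := F) (fun x => congrFun hleft x),
      Function.RightInverse.surjective (g := F) hright⟩
  refine ⟨hbf, hfC, ?_⟩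
  let H : X ≃ₜ X := ⟨⟨f, F, fun x => congrFun hleft x, hright⟩, hcont, F.continuous⟩
  have hinv : Function.invFun f = H.symm := by
    funext y
    apply hbf.1
    rw [Function.invFun_eq (hbf.2 y)]
    exact (hright y).symm
  rw [hinv]
  exact H.contDiff_symm hD hfC
end

section
/- Let X be a Banach space over ℝ or ℂ and suppose f := I + K + C : X → X is weakly coercive, where I is the identity, K : X → X is a linear k-contractive operator with k ∈ [0,1), C : X → X is a C¹ compact operator, and for every x ∈ X the operator I + K + C′(x) is weakly coercive. Then the operator −K − C : X → X has exactly one fixed point, i.e. there is a unique x ∈ X with −K(x) − C(x) = x. -/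
open Filter Topology

/-- A proper local homeomorphism of a real topological vector space to itself is bijective. -/
theorem bijective_of_proper_local_homeo {X : Type*} [NormedAddCommGroup X] [NormedSpace ℝ X]
    (f : X → X) (hp : IsProperMap f) (hl : IsLocalHomeomorph f) : Function.Bijective f := by
  have hcov : IsCoveringMap f := by
    rw [isCoveringMap_iff_isCoveringMapOn_univ]
    refine hp.isClosedMap.isCoveringMapOn_of_isLocalHomeomorphOn (fun y _ => ?_)
      hl.isLocalHomeomorphOn
    refine (hp.isCompact_preimage isCompact_singleton).finite
      (IsDiscrete.of_openPartialHomeomorph f (x := y) le_rfl fun e _ => ?_)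
    obtain ⟨φ, h1, h2⟩ := hl e
    exact ⟨φ, h1, h2.symm⟩
  obtain ⟨F, ⟨h0, hF⟩, -⟩ := hcov.existsUnique_continuousMap_lifts
    (ContinuousMap.id X) (f 0) 0 rfl
  have hF' : ∀ y, f (F y) = y := fun y => congrFun hF y
  have hid : (F ∘ f) = id := hcov.eq_of_comp_eq (F.continuous.comp hcov.continuous)
    continuous_id (by ext x; simp [hF']) 0 (by simpa using h0)
  exact ⟨Function.LeftInverse.injective (g := F) (congrFun hid),
    Function.RightInverse.surjective (g := F) hF'⟩

/-- The derivative of a compact map is a compact operator. -/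
theorem isCompactOperator_of_hasFDerivAt {𝕜 : Type*} [RCLike 𝕜] {X : Type*}
    [NormedAddCommGroup X] [NormedSpace 𝕜 X] [CompleteSpace X] (C : X → X)
    (hCcomp : ∀ B : Set X, Bornology.IsBounded B → IsCompact (closure (C '' B)))
    (x : X) (T : X →L[𝕜] X) (hT : HasFDerivAt C T x) : IsCompactOperator T := by
  have key := isCompactOperator_iff_isCompact_closure_image_closedBall
    (T : X →ₗ[𝕜] X) (r := 1) one_pos
  refine key.2 ?_
  refine isCompact_iff_totallyBounded_isComplete.2
    ⟨TotallyBounded.closure ?_, isClosed_closure.isComplete⟩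
  rw [Metric.totallyBounded_iff]
  intro ε hε
  have h1 := hT.isLittleO.def (c := ε / 2) (by positivity)
  obtain ⟨δ', hδ', hball⟩ := Metric.eventually_nhds_iff_ball.1 h1
  set δ := δ' / 2 with hδdef
  have hδ : 0 < δ := by positivity
  have hcp : IsCompact ((fun z : X => ((δ : 𝕜)⁻¹) • (z - C x)) ''
      closure (C '' Metric.closedBall x δ)) :=
    (hCcomp _ Metric.isBounded_closedBall).image (by fun_prop)
  obtain ⟨t, htf, ht⟩ := Metric.totallyBounded_iff.1 hcp.totallyBounded (ε / 2) (by positivity)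
  refine ⟨t, htf, ?_⟩
  rintro _ ⟨h, hh, rfl⟩
  have hh1 : ‖h‖ ≤ 1 := by simpa using hh
  have hδn : ‖(δ : 𝕜)‖ = δ := by simp [abs_of_pos hδ]
  have hδ0 : (δ : 𝕜) ≠ 0 := by simpa using hδ.ne'
  have hn : ‖(δ : 𝕜) • h‖ ≤ δ := by
    rw [norm_smul, hδn]; nlinarith
  have hmem : ((δ : 𝕜)⁻¹) • (C (x + (δ : 𝕜) • h) - C x) ∈
      ((fun z : X => ((δ : 𝕜)⁻¹) • (z - C x)) '' closure (C '' Metric.closedBall x δ)) :=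
    ⟨_, subset_closure ⟨x + (δ : 𝕜) • h, by simpa [dist_eq_norm] using hn, rfl⟩, rfl⟩
  obtain ⟨y, hy, hyd⟩ := Set.mem_iUnion₂.1 (ht hmem)
  refine Set.mem_iUnion₂.2 ⟨y, hy, ?_⟩
  have hb := hball (x + (δ : 𝕜) • h) (by
    rw [Metric.mem_ball, dist_eq_norm, add_sub_cancel_left]; linarith)
  simp only [add_sub_cancel_left, map_smul] at hb
  have hd : dist (T h) (((δ : 𝕜)⁻¹) • (C (x + (δ : 𝕜) • h) - C x)) ≤ ε / 2 := by
    rw [dist_comm, dist_eq_norm]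
    have e : ((δ : 𝕜)⁻¹) • (C (x + (δ : 𝕜) • h) - C x) - T h
        = ((δ : 𝕜)⁻¹) • (C (x + (δ : 𝕜) • h) - C x - (δ : 𝕜) • T h) := by
      rw [smul_sub _ (C (x + (δ : 𝕜) • h) - C x), inv_smul_smul₀ hδ0]
    rw [e, norm_smul, norm_inv, hδn, inv_mul_le_iff₀ hδ]
    calc _ ≤ _ := hb
      _ ≤ ε / 2 * δ := by gcongr
      _ = _ := by ring
  rw [Metric.mem_ball] at hyd ⊢
  change dist (T h) y < ε
  have htri := dist_triangle (T h) (((δ : 𝕜)⁻¹) • (C (x + (δ : 𝕜) • h) - C x)) y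
  linarith

/-- Sum of an invertible operator and a compact operator, when injective, is invertible. -/
theorem exists_equiv_add_compact {𝕜 : Type*} [RCLike 𝕜] {X : Type*}
    [NormedAddCommGroup X] [NormedSpace 𝕜 X] [CompleteSpace X] (A : X ≃L[𝕜] X) (T : X →L[𝕜] X)
    (hT : IsCompactOperator T) (hinj : ∀ v, A v + T v = 0 → v = 0) :
    ∃ e : X ≃L[𝕜] X, (e : X →L[𝕜] X) = (A : X →L[𝕜] X) + T := by
  let S : X →L[𝕜] X := (A.symm : X →L[𝕜] X) ∘L T
  have hS : IsCompactOperator S := hT.clm_comp (A.symm : X →L[𝕜] X)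
  rcases hS.hasEigenvalue_or_mem_resolventSet (μ := (-1 : 𝕜)) (by simp) with h | h
  · exfalso
    obtain ⟨v, hv⟩ := h.exists_hasEigenvector
    have h1 : A.symm (T v) = -v := by simpa [S] using hv.apply_eq_smul
    have h2 : T v = -A v := by
      have := congrArg A h1
      simpa using this
    exact hv.2 (hinj v (by rw [h2]; simp))
  · rw [spectrum.mem_resolventSet_iff, ContinuousLinearMap.isUnit_iff_bijective] at h
    have hb : Function.Bijective ((A : X →L[𝕜] X) + T) := by
      have : ⇑((A : X →L[𝕜] X) + T) =
          (fun z => -z) ∘ A ∘ ((algebraMap 𝕜 (X →L[𝕜] X)) (-1) - S) := by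
        ext v
        simp [S, add_comm]
      rw [this]
      exact (neg_involutive.bijective).comp (A.bijective.comp h)
    refine ⟨ContinuousLinearEquiv.ofBijective _ (LinearMap.ker_eq_bot.2 hb.1)
      (LinearMap.range_eq_top.2 hb.2), ?_⟩
    ext v
    rfl

theorem isProperMap_of_weaklyCoercive {𝕜 : Type*} [RCLike 𝕜] {X : Type*}
    [NormedAddCommGroup X] [NormedSpace 𝕜 X] [CompleteSpace X] (A : X ≃L[𝕜] X) (C : X → X)
    (hC : Continuous C)
    (hCcomp : ∀ B : Set X, Bornology.IsBounded B → IsCompact (closure (C '' B)))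
    (hwc : WeaklyCoercive (fun x : X => A x + C x)) :
    IsProperMap (fun x : X => A x + C x) := by
  have hc : Continuous (fun x : X => A x + C x) := A.continuous.add hC
  rw [isProperMap_iff_isCompact_preimage]
  refine ⟨hc, fun Q hQ => ?_⟩
  set P := (fun x : X => A x + C x) ⁻¹' Q with hP
  have hbd : Bornology.IsBounded P := by
    by_contra hnb
    rw [isBounded_iff_forall_norm_le] at hnb
    push Not at hnb
    choose u hu hun using fun n : ℕ => hnb n
    have h1 := (hwc u).2 (tendsto_atTop_mono (fun n => (hun n).le) tendsto_natCast_atTop_atTop)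
    obtain ⟨R, hR⟩ := isBounded_iff_forall_norm_le.1 hQ.isBounded
    obtain ⟨n, hn⟩ := (h1.eventually_gt_atTop R).exists
    exact absurd (hR _ (hu n)) (not_le.2 hn)
  have hcp : IsCompact ((fun p : X × X => A.symm (p.1 - p.2)) '' (Q ×ˢ closure (C '' P))) :=
    (hQ.prod (hCcomp P hbd)).image (by fun_prop)
  refine hcp.of_isClosed_subset (hQ.isClosed.preimage hc) ?_
  intro x hx
  exact ⟨(A x + C x, C x), ⟨hx, subset_closure ⟨x, hx, rfl⟩⟩, by simp⟩

/-- Let `f := I + K + C : X → X` be weakly coercive, where `K` is a linear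
`k`-contractive operator (`‖K‖ ≤ k < 1`), `C` is a `C¹` compact operator, and
`I + K + C′(x)` is weakly coercive for every `x`. Then the operator `−K − C` has exactly
one fixed point: there is a unique `x ∈ X` with `−K(x) − C(x) = x`. -/
theorem neg_contractive_plus_compact_has_unique_fixed_point
    {𝕜 : Type*} [RCLike 𝕜] {X : Type*} [NormedAddCommGroup X] [NormedSpace 𝕜 X]
    [CompleteSpace X] (K : X →L[𝕜] X) (k : ℝ) (hk0 : 0 ≤ k) (hk1 : k < 1)
    (hK : ‖K‖ ≤ k) (C : X → X) (hC : ContDiff 𝕜 1 C)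
    (hCcomp : ∀ B : Set X, Bornology.IsBounded B → IsCompact (closure (C '' B)))
    (hwc : WeaklyCoercive (fun x : X => x + K x + C x))
    (hderiv : ∀ x : X, WeaklyCoercive (fun y : X => y + K y + fderiv 𝕜 C x y)) :
    ∃! x : X, -K x - C x = x := by
  have hA : ∃ A : X ≃L[𝕜] X, ∀ x, A x = x + K x := by
    have hu : IsUnit (1 - (-K)) := isUnit_one_sub_of_norm_lt_one (by
      rw [norm_neg]; exact lt_of_le_of_lt hK hk1)
    rw [ContinuousLinearMap.isUnit_iff_bijective] at hu
    exact ⟨ContinuousLinearEquiv.ofBijective _ (LinearMap.ker_eq_bot.2 hu.1)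
      (LinearMap.range_eq_top.2 hu.2), fun x => by simp⟩
  obtain ⟨A, hA⟩ := hA
  simp only [← hA] at hwc hderiv
  let : NormedSpace ℝ X := NormedSpace.restrictScalars ℝ 𝕜 X
  have hp := isProperMap_of_weaklyCoercive A C hC.continuous hCcomp hwc
  have hl : IsLocalHomeomorph (fun x : X => A x + C x) := by
    refine IsLocalHomeomorph.mk _ fun x => ?_
    have hs : HasStrictFDerivAt C (fderiv 𝕜 C x) x :=
      hC.contDiffAt.hasStrictFDerivAt one_ne_zero
    have hT := isCompactOperator_of_hasFDerivAt C hCcomp x _ hs.hasFDerivAt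
    obtain ⟨e, he⟩ := exists_equiv_add_compact A (fderiv 𝕜 C x) hT (by
      intro v hv
      by_contra hv0
      have h1 := (hderiv x (fun n : ℕ => (n : 𝕜) • v)).2 (by
        simp only [norm_smul, RCLike.norm_natCast]
        exact tendsto_natCast_atTop_atTop.atTop_mul_const (norm_pos_iff.2 hv0))
      simp only [map_smul, ← smul_add, hv, smul_zero, norm_zero] at h1
      exact not_tendsto_const_atTop _ _ h1)
    have hf : HasStrictFDerivAt (fun x : X => A x + C x) (e : X →L[𝕜] X) x := by
      rw [he]
      exact (A : X →L[𝕜] X).hasStrictFDerivAt.add hs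
    exact ⟨hf.toOpenPartialHomeomorph _, hf.mem_toOpenPartialHomeomorph_source,
      fun _ _ => rfl⟩
  have hb := bijective_of_proper_local_homeo _ hp hl
  have hiff : ∀ x, A x + C x = 0 ↔ -K x - C x = x := by
    intro x
    rw [hA, eq_comm (b := x), ← sub_eq_zero (a := x)]
    constructor <;> intro h <;> rw [← h] <;> abel
  obtain ⟨x, hx, hux⟩ := hb.existsUnique 0
  exact ⟨x, (hiff x).1 hx, fun y hy => hux y ((hiff y).2 hy)⟩
end
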